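/- Let α ∈ (0,2). There exists a constant λ* > 0 such that: (1) for every λ > λ*, the set {a ∈ (0,1) : Ψ(a) = λ} has at least two elements; (2) the set {a ∈ (0,1) : Ψ(a) = λ*} has at least one element; (3) for every 0 < λ < λ*, the set {a ∈ (0,1) : Ψ(a) = λ} is empty. -/

import Mathlib

open MeasureTheory Real Filter Set

/-- Euler Beta function `B(x,y) = ∫₀¹ t^(x-1) (1-t)^(y-1) dt`. -/
noncomputable def betaFn (x y : ℝ) : ℝ :=
  ∫ t in (0:ℝ)..1, t ^ (x - 1) * (1 - t) ^ (y - 1)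

/-- `C_α = π⁻¹ sin(π α / 2)`. -/
noncomputable def Cc (α : ℝ) : ℝ := Real.sin (Real.pi * α / 2) / Real.pi

/-- `T_α = B(α, 1 - α/2)`. -/
noncomputable def Tc (α : ℝ) : ℝ := betaFn α (1 - α / 2)

/-- Poisson kernel of the fractional Laplacian for the interval `(a,1)`:
`P_{(a,1)}(x,y) = C_α (((x-a)(1-x))/((y-a)(y-1)))^(α/2) |x-y|⁻¹`. -/
noncomputable def Pker (α a x y : ℝ) : ℝ :=
  Cc α * (((x - a) * (1 - x)) / ((y - a) * (y - 1))) ^ (α / 2) * |x - y|⁻¹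

/-- `fseq α a n` is `f_a^{(n+1)}`: `f_a^{(1)}(x) = ∫_{-a}^a P_{(a,1)}(x,y) dy` and
`f_a^{(n)}(x) = ∫_a^1 P_{(a,1)}(x,-y) f_a^{(n-1)}(y) dy` for `n ≥ 2`. -/
noncomputable def fseq (α a : ℝ) : ℕ → ℝ → ℝ
  | 0 => fun x => ∫ y in (-a)..a, Pker α a x y
  | n + 1 => fun x => ∫ y in a..(1:ℝ), Pker α a x (-y) * fseq α a n y

/-- `f_a(x) = Σ_{n=1}^∞ f_a^{(n)}(x)`. -/
noncomputable def ff (α a x : ℝ) : ℝ := ∑' n : ℕ, fseq α a n x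

/-- `Φ(a,y) = ((y-a)(y-1))^(-α/2) |y-a|⁻¹`. -/
noncomputable def Phi (α a y : ℝ) : ℝ :=
  ((y - a) * (y - 1)) ^ (-(α / 2)) * |y - a|⁻¹

/-- `Ψ(a) = C_α (1-a)^(α/2) (∫_1^∞ Φ(a,y) dy + ∫_a^∞ Φ(a,-y) dy - ∫_a^1 Φ(a,-y) f_a(y) dy)`. -/
noncomputable def Psi (α a : ℝ) : ℝ :=
  Cc α * (1 - a) ^ (α / 2) *
    ((∫ y in Set.Ioi (1:ℝ), Phi α a y) + (∫ y in Set.Ioi a, Phi α a (-y))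
      - ∫ y in a..(1:ℝ), Phi α a (-y) * ff α a y)

theorem Pker_eq_of_nonneg {α t y : ℝ} (ht : 0 ≤ t * (1 - t)) (hy : 0 ≤ y * (y - 1)) :
    Pker α 0 t y =
      Cc α * (t * (1 - t)) ^ (α / 2) * ((y * (y - 1)) ^ (-(α / 2)) * |t - y|⁻¹) := by
  simp only [Pker, sub_zero]
  rw [Real.div_rpow ht hy, Real.rpow_neg hy]
  ring

theorem Cc_pos {α : ℝ} (hα : α ∈ Ioo (0 : ℝ) 2) : 0 < Cc α := by
  obtain ⟨h0, h2⟩ := hα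
  refine div_pos (Real.sin_pos_of_pos_of_lt_pi (by positivity) ?_) Real.pi_pos
  nlinarith [Real.pi_pos]

theorem Cc_eq_one_div_beta {α : ℝ} :
    Cc α = 1 / ProbabilityTheory.beta (1 - α / 2) (α / 2) := by
  rw [ProbabilityTheory.beta, mul_comm (Real.Gamma _), Real.Gamma_mul_Gamma_one_sub]
  simp [Cc, mul_div_assoc]

theorem bijOn_quadratic_ratio {c : ℝ} (hc : 0 < c) :
    BijOn (fun z : ℝ => z * (z - 1) / (z * (z - 1) + c)) (Ioi 1) (Ioo 0 1) := by
  refine ⟨?_, ?_, ?_⟩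
  · intro z hz
    have hz : 1 < z := hz
    have h : 0 < z * (z - 1) := mul_pos (by linarith) (by linarith)
    exact ⟨by positivity, by rw [div_lt_one (by positivity)]; linarith⟩
  · intro z hz w hw h
    have hz : 1 < z := hz
    have hw : 1 < w := hw
    have h1 : 0 < z * (z - 1) := mul_pos (by linarith) (by linarith)
    have h2 : 0 < w * (w - 1) := mul_pos (by linarith) (by linarith)
    simp only at h
    rw [div_eq_div_iff (by positivity) (by positivity)] at h
    have h3 : c * ((z - w) * (z + w - 1)) = 0 := by linear_combination h
    have : z + w - 1 ≠ 0 := by linarith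
    have := hc.ne'
    simp_all
    linarith
  · rintro x ⟨hx0, hx1⟩
    have h1x : 0 < 1 - x := by linarith
    set u := c * x / (1 - x) with hu
    have hu0 : 0 < u := by positivity
    have hs : √(1 + 4 * u) ^ 2 = 1 + 4 * u := Real.sq_sqrt (by positivity)
    have hs1 : 1 < √(1 + 4 * u) := by
      rw [Real.lt_sqrt (by norm_num)]; linarith
    refine ⟨(1 + √(1 + 4 * u)) / 2, by simp only [mem_Ioi]; linarith, ?_⟩
    have : (1 + √(1 + 4 * u)) / 2 * ((1 + √(1 + 4 * u)) / 2 - 1) = u := by linarith [hs]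
    simp only [this]
    rw [div_eq_iff (by positivity), hu]
    field_simp
    ring

theorem lintegral_Pker_eq_one {α t : ℝ} (hα : α ∈ Ioo (0 : ℝ) 2) (ht : t ∈ Ioo (0 : ℝ) 1) :
    ∫⁻ z in Ioi (1 : ℝ), ENNReal.ofReal (Pker α 0 t z + Pker α 0 t (1 - z)) = 1 := by
  obtain ⟨h0, h2⟩ := hα
  obtain ⟨ht0, ht1⟩ := ht
  have hc : 0 < t * (1 - t) := mul_pos ht0 (by linarith)
  set c := t * (1 - t) with hc'
  have hβ := ProbabilityTheory.lintegral_betaPDF_eq_one (α := 1 - α / 2) (β := α / 2)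
    (by linarith) (by linarith)
  rw [ProbabilityTheory.lintegral_betaPDF, ← (bijOn_quadratic_ratio hc).image_eq,
    lintegral_image_eq_lintegral_abs_deriv_mul measurableSet_Ioi
      (f' := fun z => c * (2 * z - 1) / (z * (z - 1) + c) ^ 2) ?_
      (bijOn_quadratic_ratio hc).injOn] at hβ
  · rw [← hβ]
    refine setLIntegral_congr_fun measurableSet_Ioi fun z hz => ?_
    have hz : 1 < z := hz
    have hu : 0 < z * (z - 1) := mul_pos (by linarith) (by linarith)
    have hzt : z * (z - 1) + c = (z - t) * (z - 1 + t) := by rw [hc']; ring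
    have e1 : t - z < 0 := by linarith
    have e2 : 0 < t - (1 - z) := by linarith
    have e3 : 0 < z - t := by linarith
    have e4 : 0 < 2 * z - 1 := by linarith
    rw [← ENNReal.ofReal_mul (by positivity), ← Cc_eq_one_div_beta]
    congr 1
    rw [Pker_eq_of_nonneg hc.le hu.le, Pker_eq_of_nonneg hc.le (by nlinarith), ← hc',
      show (1 - z) * (1 - z - 1) = z * (z - 1) by ring, abs_of_neg e1, abs_of_pos e2]
    set u := z * (z - 1) with hu'
    have e5 : 1 - u / (u + c) = c / (u + c) := by field_simp; ring
    have hd : 0 < c * (2 * z - 1) / (u + c) ^ 2 := by positivity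
    rw [e5, show 1 - α / 2 - 1 = -(α / 2) by ring, Real.rpow_sub_one (by positivity),
      Real.div_rpow hu.le (by positivity), Real.div_rpow hc.le (by positivity),
      abs_of_pos hd, Real.rpow_neg (by positivity), Real.rpow_neg (x := u + c) (by positivity)]
    have p1 : 0 < (u + c) ^ (α / 2) := by positivity
    have p2 : 0 < u ^ (α / 2) := by positivity
    have p3 : 0 < c ^ (α / 2) := by positivity
    have key : (-(t - z))⁻¹ + (t - (1 - z))⁻¹ = (2 * z - 1) / (u + c) := by
      rw [hzt]
      have : z - 1 + t ≠ 0 := by linarith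
      have : t - z ≠ 0 := by linarith
      have : t - (1 - z) ≠ 0 := by linarith
      field_simp
      ring
    calc _ = Cc α * c ^ (α / 2) * (u ^ (α / 2))⁻¹ *
          ((-(t - z))⁻¹ + (t - (1 - z))⁻¹) := by ring
      _ = _ := by rw [key]; field_simp
  · intro z hz
    have hz : 1 < z := hz
    have hu : 0 < z * (z - 1) := mul_pos (by linarith) (by linarith)
    have hd : HasDerivAt (fun z : ℝ => z * (z - 1)) (1 * (z - 1) + z * 1) z :=
      (hasDerivAt_id z).mul ((hasDerivAt_id z).sub_const 1)
    refine HasDerivAt.hasDerivWithinAt ?_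
    convert! hd.div (hd.add_const c) (by positivity) using 1
    congr 1
    ring

theorem measurable_Pker (α a : ℝ) : Measurable fun p : ℝ × ℝ => Pker α a p.1 p.2 := by
  unfold Pker
  fun_prop

theorem measurable_Pker_right (α a t : ℝ) : Measurable fun z => Pker α a t z := by
  unfold Pker
  fun_prop

theorem measurable_Phi (α a : ℝ) : Measurable (Phi α a) := by
  unfold Phi
  fun_prop

theorem Pker_nonneg {α t y : ℝ} (hα : α ∈ Ioo (0 : ℝ) 2) (ht : t ∈ Icc (0 : ℝ) 1)
    (hy : 0 ≤ y * (y - 1)) : 0 ≤ Pker α 0 t y := by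
  have := Cc_pos hα
  have ht' : 0 ≤ t * (1 - t) := mul_nonneg ht.1 (by linarith [ht.2])
  rw [Pker_eq_of_nonneg ht' hy]
  positivity

theorem measurePreserving_one_sub :
    MeasurePreserving (fun z : ℝ => 1 - z) volume volume :=
  Measure.measurePreserving_sub_left volume (1 : ℝ)

theorem Iio_zero_preimage : (fun z : ℝ => 1 - z) ⁻¹' Iio 0 = Ioi 1 := by
  ext z; simp

theorem integrableOn_Pker_aux {α t : ℝ} (hα : α ∈ Ioo (0 : ℝ) 2) (ht : t ∈ Ioo (0 : ℝ) 1) :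
    IntegrableOn (fun z => Pker α 0 t z + Pker α 0 t (1 - z)) (Ioi 1) := by
  have hm := measurable_Pker_right α 0 t
  refine ⟨(hm.add (hm.comp (measurable_const.sub measurable_id))).aestronglyMeasurable, ?_⟩
  rw [hasFiniteIntegral_iff_ofReal, lintegral_Pker_eq_one hα ht]
  · simp
  · refine (ae_restrict_iff' measurableSet_Ioi).2 (.of_forall fun z hz => ?_)
    have hz : 1 < z := hz
    exact add_nonneg (Pker_nonneg hα (Ioo_subset_Icc_self ht) (by nlinarith))
      (Pker_nonneg hα (Ioo_subset_Icc_self ht) (by nlinarith))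

theorem integrableOn_Pker_Ioi {α t : ℝ} (hα : α ∈ Ioo (0 : ℝ) 2) (ht : t ∈ Ioo (0 : ℝ) 1) :
    IntegrableOn (fun z => Pker α 0 t z) (Ioi 1) := by
  have hm := measurable_Pker_right α 0 t
  refine (integrableOn_Pker_aux hα ht).mono' hm.aestronglyMeasurable ?_
  refine (ae_restrict_iff' measurableSet_Ioi).2 (.of_forall fun z hz => ?_)
  have hz : 1 < z := hz
  have h1 := Pker_nonneg hα (Ioo_subset_Icc_self ht) (y := z) (by nlinarith)
  have h2 := Pker_nonneg hα (Ioo_subset_Icc_self ht) (y := 1 - z) (by nlinarith)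
  rw [Real.norm_of_nonneg h1]
  linarith

theorem integrableOn_Pker_one_sub {α t : ℝ} (hα : α ∈ Ioo (0 : ℝ) 2) (ht : t ∈ Ioo (0 : ℝ) 1) :
    IntegrableOn (fun z => Pker α 0 t (1 - z)) (Ioi 1) := by
  refine ((integrableOn_Pker_aux hα ht).sub (integrableOn_Pker_Ioi hα ht)).congr
    (.of_forall fun z => ?_)
  simp

theorem integrableOn_Pker_Iio {α t : ℝ} (hα : α ∈ Ioo (0 : ℝ) 2) (ht : t ∈ Ioo (0 : ℝ) 1) :
    IntegrableOn (fun z => Pker α 0 t z) (Iio 0) := by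
  rw [← measurePreserving_one_sub.integrableOn_comp_preimage
    (MeasurableEquiv.subLeft (1 : ℝ)).measurableEmbedding, Iio_zero_preimage]
  exact integrableOn_Pker_one_sub hα ht

/-- The Poisson kernel of `(0, 1)` has total mass one. -/
theorem integral_Pker_add {α t : ℝ} (hα : α ∈ Ioo (0 : ℝ) 2) (ht : t ∈ Ioo (0 : ℝ) 1) :
    (∫ z in Ioi (1 : ℝ), Pker α 0 t z) + ∫ z in Iio (0 : ℝ), Pker α 0 t z = 1 := by
  rw [← measurePreserving_one_sub.setIntegral_preimage_emb
    (MeasurableEquiv.subLeft (1 : ℝ)).measurableEmbedding _ (Iio 0), Iio_zero_preimage,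
    ← integral_add (integrableOn_Pker_Ioi hα ht) (integrableOn_Pker_one_sub hα ht),
    integral_eq_lintegral_of_nonneg_ae, lintegral_Pker_eq_one hα ht]
  · simp
  · refine (ae_restrict_iff' measurableSet_Ioi).2 (.of_forall fun z hz => ?_)
    have hz : 1 < z := hz
    exact add_nonneg (Pker_nonneg hα (Ioo_subset_Icc_self ht) (by nlinarith))
      (Pker_nonneg hα (Ioo_subset_Icc_self ht) (by nlinarith))
  · exact (integrableOn_Pker_aux hα ht).aestronglyMeasurable

theorem Phi_nonneg {α y : ℝ} (hy : 0 ≤ y * (y - 1)) : 0 ≤ Phi α 0 y := by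
  simp only [Phi, sub_zero]
  positivity

theorem mul_Phi_le_Pker {α t z : ℝ} (hα : α ∈ Ioo (0 : ℝ) 2) (ht : t ∈ Icc (0 : ℝ) 1)
    (hz : 1 < z) : Cc α * (t * (1 - t)) ^ (α / 2) * Phi α 0 z ≤ Pker α 0 t z := by
  have hκ := Cc_pos hα
  have ht' : 0 ≤ t * (1 - t) := mul_nonneg ht.1 (by linarith [ht.2])
  have hz' : 0 ≤ z * (z - 1) := by nlinarith
  rw [Pker_eq_of_nonneg ht' hz']
  simp only [Phi, sub_zero]
  have h1 : |t - z| ≤ |z| := by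
    rw [abs_of_nonpos (by linarith [ht.2]), abs_of_pos (by linarith)]
    linarith [ht.1]
  have h2 : 0 < |t - z| := abs_pos.2 (by linarith [ht.2])
  gcongr

theorem Pker_le_mul_Phi {α t w : ℝ} (hα : α ∈ Ioo (0 : ℝ) 2) (ht : t ∈ Icc (0 : ℝ) 1)
    (hw : w < 0) : Pker α 0 t w ≤ Cc α * (t * (1 - t)) ^ (α / 2) * Phi α 0 w := by
  have hκ := Cc_pos hα
  have ht' : 0 ≤ t * (1 - t) := mul_nonneg ht.1 (by linarith [ht.2])
  have hw' : 0 ≤ w * (w - 1) := by nlinarith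
  rw [Pker_eq_of_nonneg ht' hw']
  simp only [Phi, sub_zero]
  have h1 : |w| ≤ |t - w| := by
    rw [abs_of_neg hw, abs_of_pos (by linarith [ht.1])]
    linarith [ht.1]
  have h2 : 0 < |w| := abs_pos.2 hw.ne
  gcongr

theorem Phi_monotoneOn {α : ℝ} (hα : α ∈ Ioo (0 : ℝ) 2) : MonotoneOn (Phi α 0) (Iio 0) := by
  intro v hv w hw hvw
  have hv : v < 0 := hv
  have hw : w < 0 := hw
  have h0 : 0 < α := hα.1
  simp only [Phi, sub_zero]
  rw [abs_of_neg hv, abs_of_neg hw]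
  have h1 : 0 < w * (w - 1) := by nlinarith
  have h2 : w * (w - 1) ≤ v * (v - 1) := by nlinarith
  have h3 := Real.rpow_le_rpow_of_nonpos h1 h2 (by linarith : -(α / 2) ≤ 0)
  have h4 : 0 < -w := by linarith
  have h5 : 0 < -v := by linarith
  gcongr

theorem Phi_pos_of_neg {α w : ℝ} (hw : w < 0) : 0 < Phi α 0 w := by
  simp only [Phi, sub_zero]
  have h1 : 0 < w * (w - 1) := by nlinarith
  have h2 : 0 < |w| := abs_pos.2 hw.ne
  positivity

theorem integrableOn_Phi_Ioi {α : ℝ} (hα : α ∈ Ioo (0 : ℝ) 2) :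
    IntegrableOn (Phi α 0) (Ioi 1) := by
  have ht : (1 / 2 : ℝ) ∈ Ioo (0 : ℝ) 1 := by constructor <;> norm_num
  have hκ := Cc_pos hα
  have hc : 0 < Cc α * ((1 / 2 : ℝ) * (1 - 1 / 2)) ^ (α / 2) := by positivity
  refine ((integrableOn_Pker_Ioi hα ht).const_mul
    (Cc α * ((1 / 2 : ℝ) * (1 - 1 / 2)) ^ (α / 2))⁻¹).mono'
    (measurable_Phi α 0).aestronglyMeasurable ?_
  refine (ae_restrict_iff' measurableSet_Ioi).2 (.of_forall fun z hz => ?_)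
  have hz : 1 < z := hz
  rw [Real.norm_of_nonneg (Phi_nonneg (by nlinarith)), le_inv_mul_iff₀ hc]
  exact mul_Phi_le_Pker hα (Ioo_subset_Icc_self ht) hz

/-- The total mass of `Phi α 0` on the exterior half-line `(1, ∞)`. -/
noncomputable def exteriorMass (α : ℝ) : ℝ := ∫ y in Ioi (1 : ℝ), Phi α 0 y

theorem exteriorMass_pos {α : ℝ} (hα : α ∈ Ioo (0 : ℝ) 2) : 0 < exteriorMass α := by
  rw [exteriorMass, setIntegral_pos_iff_support_of_nonneg_ae _ (integrableOn_Phi_Ioi hα)]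
  · have : Function.support (Phi α 0) ∩ Ioi 1 = Ioi 1 := by
      refine inter_eq_right.2 fun z hz => ?_
      have hz : 1 < z := hz
      have h1 : 0 < z * (z - 1) := by nlinarith
      have h2 : 0 < |z| := abs_pos.2 (by linarith)
      have : 0 < Phi α 0 z := by
        simp only [Phi, sub_zero]
        positivity
      exact this.ne'
    rw [this]
    simp
  · refine (ae_restrict_iff' measurableSet_Ioi).2 (.of_forall fun z hz => ?_)
    have hz : 1 < z := hz
    exact Phi_nonneg (by nlinarith)

theorem Pker_of_mul_eq_zero {α t y : ℝ} (hα : α ∈ Ioo (0 : ℝ) 2) (ht : t * (1 - t) = 0) :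
    Pker α 0 t y = 0 := by
  have : α / 2 ≠ 0 := by linarith [hα.1]
  simp [Pker, ht, Real.zero_rpow this]

theorem intervalIntegrable_Pker {α t : ℝ} (hα : α ∈ Ioo (0 : ℝ) 2) (ht : t ∈ Icc (0 : ℝ) 1)
    {u v : ℝ} (huv : u ≤ v) (hv : v ≤ 0) :
    IntervalIntegrable (fun z => Pker α 0 t z) volume u v := by
  rcases eq_or_ne (t * (1 - t)) 0 with h | h
  · simp [Pker_of_mul_eq_zero hα h]
  · have ht' : t ∈ Ioo (0 : ℝ) 1 := by
      refine ⟨ht.1.lt_of_ne ?_, ht.2.lt_of_ne ?_⟩ <;> rintro rfl <;> simp at h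
    rw [intervalIntegrable_iff_integrableOn_Ioo_of_le huv]
    exact (integrableOn_Pker_Iio hα ht').mono_set fun z hz => hz.2.trans_le hv

theorem integral_Pker_le {α t b : ℝ} (hα : α ∈ Ioo (0 : ℝ) 2) (ht : t ∈ Icc (0 : ℝ) 1)
    (hb : 0 < b) :
    (∫ z in (-b)..0, Pker α 0 t z) + ∫ τ in (0 : ℝ)..1, Pker α 0 t (-b - τ) ≤
      1 - Cc α * (t * (1 - t)) ^ (α / 2) * exteriorMass α := by
  rcases eq_or_ne (t * (1 - t)) 0 with h | h
  · have : α / 2 ≠ 0 := by linarith [hα.1]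
    simp [Pker_of_mul_eq_zero hα h, h, Real.zero_rpow this]
  · have ht' : t ∈ Ioo (0 : ℝ) 1 := by
      refine ⟨ht.1.lt_of_ne ?_, ht.2.lt_of_ne ?_⟩ <;> rintro rfl <;> simp at h
    rw [intervalIntegral.integral_comp_sub_left (fun z => Pker α 0 t z), add_comm, sub_zero,
      intervalIntegral.integral_add_adjacent_intervals
        (intervalIntegrable_Pker hα ht (by linarith) (by linarith))
        (intervalIntegrable_Pker hα ht (by linarith) le_rfl),
      intervalIntegral.integral_of_le (by linarith), integral_Ioc_eq_integral_Ioo]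
    have h0 := integral_Pker_add hα ht'
    have h1 : ∫ z in Ioo (-b - 1) 0, Pker α 0 t z ≤ ∫ z in Iio (0 : ℝ), Pker α 0 t z := by
      refine setIntegral_mono_set (integrableOn_Pker_Iio hα ht') ?_
        (LE.le.eventuallyLE fun z hz => hz.2)
      refine (ae_restrict_iff' measurableSet_Iio).2 (.of_forall fun z hz => ?_)
      have hz : z < 0 := hz
      exact Pker_nonneg hα ht (by nlinarith)
    have h2 : Cc α * (t * (1 - t)) ^ (α / 2) * exteriorMass α ≤
        ∫ z in Ioi (1 : ℝ), Pker α 0 t z := by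
      rw [exteriorMass, ← integral_const_mul]
      exact setIntegral_mono_on ((integrableOn_Phi_Ioi hα).const_mul _)
        (integrableOn_Pker_Ioi hα ht') measurableSet_Ioi fun z hz => mul_Phi_le_Pker hα ht hz
    linarith

/-- The kernel mass is at most `contractionRatio α b`, uniformly on `[0, 1]`. -/
noncomputable def contractionRatio (α b : ℝ) : ℝ :=
  Phi α 0 (-b) / (Phi α 0 (-b) + exteriorMass α)

theorem contractionRatio_nonneg {α b : ℝ} (hα : α ∈ Ioo (0 : ℝ) 2) (hb : 0 < b) :
    0 ≤ contractionRatio α b := by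
  have h1 := exteriorMass_pos hα
  have h2 : 0 < Phi α 0 (-b) := Phi_pos_of_neg (by linarith)
  unfold contractionRatio
  positivity

theorem contractionRatio_lt_one {α b : ℝ} (hα : α ∈ Ioo (0 : ℝ) 2) (hb : 0 < b) :
    contractionRatio α b < 1 := by
  have h1 := exteriorMass_pos hα
  have h2 : 0 < Phi α 0 (-b) := Phi_pos_of_neg (by linarith)
  unfold contractionRatio
  rw [div_lt_one (by positivity)]
  linarith

theorem intervalIntegrable_Pker_sub {α t b : ℝ} (hα : α ∈ Ioo (0 : ℝ) 2)
    (ht : t ∈ Icc (0 : ℝ) 1) (hb : 0 < b) :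
    IntervalIntegrable (fun τ => Pker α 0 t (-b - τ)) volume 0 1 := by
  simpa using ((intervalIntegrable_Pker hα ht (u := -b - 1) (v := -b)
    (by linarith) (by linarith)).comp_sub_left (-b)).symm

theorem integral_Pker_le_contractionRatio {α t b b₀ : ℝ} (hα : α ∈ Ioo (0 : ℝ) 2)
    (ht : t ∈ Icc (0 : ℝ) 1) (hb₀ : 0 < b₀) (hb : b₀ ≤ b) :
    ∫ τ in (0 : ℝ)..1, Pker α 0 t (-b - τ) ≤ contractionRatio α b₀ := by
  have hκ := Cc_pos hα
  have hA := exteriorMass_pos hα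
  have hΦ : 0 < Phi α 0 (-b₀) := Phi_pos_of_neg (by linarith)
  have ht' : 0 ≤ t * (1 - t) := mul_nonneg ht.1 (by linarith [ht.2])
  set w := (t * (1 - t)) ^ (α / 2) with hw
  have hw0 : 0 ≤ w := by positivity
  have h1 := integral_Pker_le hα ht (hb₀.trans_le hb)
  have h2 : 0 ≤ ∫ z in (-b)..0, Pker α 0 t z :=
    intervalIntegral.integral_nonneg (by linarith) fun z hz =>
      Pker_nonneg hα ht (by nlinarith [hz.2])
  have h3 : ∫ τ in (0 : ℝ)..1, Pker α 0 t (-b - τ) ≤ Cc α * w * Phi α 0 (-b₀) := by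
    calc ∫ τ in (0 : ℝ)..1, Pker α 0 t (-b - τ)
        ≤ ∫ τ in (0 : ℝ)..1, Cc α * w * Phi α 0 (-b₀) := by
          refine intervalIntegral.integral_mono_on (by norm_num)
            (intervalIntegrable_Pker_sub hα ht (hb₀.trans_le hb)) (by simp) fun τ hτ => ?_
          refine (Pker_le_mul_Phi hα ht (by linarith [hτ.1])).trans ?_
          have := Phi_monotoneOn hα (a := -b - τ) (b := -b₀)
            (by simp only [mem_Iio]; linarith [hτ.1]) (by simp only [mem_Iio]; linarith)
            (by linarith [hτ.1])
          gcongr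
      _ = _ := by simp
  rw [contractionRatio, le_div_iff₀ (by positivity)]
  rw [← hw] at h1
  nlinarith [mul_le_mul_of_nonneg_left h3 hA.le,
    mul_le_mul_of_nonneg_left (show ∫ τ in (0 : ℝ)..1, Pker α 0 t (-b - τ) ≤
      1 - Cc α * w * exteriorMass α by linarith) hΦ.le]

/-- The functions `fseq` transported to the unit interval, where the gap between the two components
of the domain has length `b = 2 * a / (1 - a)`. -/
noncomputable def unitSeq (α b : ℝ) : ℕ → ℝ → ℝ
  | 0 => fun t => ∫ z in (-b)..0, Pker α 0 t z
  | n + 1 => fun t => ∫ τ in (0 : ℝ)..1, Pker α 0 t (-b - τ) * unitSeq α b n τ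

theorem measurable_unitSeq {α b : ℝ} (hb : 0 < b) (n : ℕ) : Measurable (unitSeq α b n) := by
  induction n with
  | zero =>
    simp only [unitSeq]
    simp_rw [intervalIntegral.integral_of_le (show -b ≤ 0 by linarith)]
    exact ((measurable_Pker α 0).stronglyMeasurable.integral_prod_right).measurable
  | succ n ih =>
    simp only [unitSeq]
    simp_rw [intervalIntegral.integral_of_le (zero_le_one (α := ℝ))]
    have h : Measurable fun p : ℝ × ℝ => Pker α 0 p.1 (-b - p.2) * unitSeq α b n p.2 :=
      ((measurable_Pker α 0).comp
        (measurable_fst.prodMk (measurable_const.sub measurable_snd))).mul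
        (ih.comp measurable_snd)
    exact h.stronglyMeasurable.integral_prod_right.measurable

theorem unitSeq_nonneg {α b : ℝ} (hα : α ∈ Ioo (0 : ℝ) 2) (hb : 0 < b) (n : ℕ) :
    ∀ t ∈ Icc (0 : ℝ) 1, 0 ≤ unitSeq α b n t := by
  induction n with
  | zero =>
    intro t ht
    exact intervalIntegral.integral_nonneg (by linarith) fun z hz =>
      Pker_nonneg hα ht (by nlinarith [hz.2])
  | succ n ih =>
    intro t ht
    exact intervalIntegral.integral_nonneg (by linarith) fun τ hτ =>
      mul_nonneg (Pker_nonneg hα ht (by nlinarith [hτ.1])) (ih τ hτ)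

theorem intervalIntegrable_Pker_mul {α t b M : ℝ} (hα : α ∈ Ioo (0 : ℝ) 2)
    (ht : t ∈ Icc (0 : ℝ) 1) (hb : 0 < b) {g : ℝ → ℝ} (hg : Measurable g)
    (hM : ∀ τ ∈ Icc (0 : ℝ) 1, |g τ| ≤ M) :
    IntervalIntegrable (fun τ => Pker α 0 t (-b - τ) * g τ) volume 0 1 := by
  have h := intervalIntegrable_Pker_sub hα ht hb
  rw [intervalIntegrable_iff_integrableOn_Ioc_of_le zero_le_one] at h ⊢
  refine h.mul_bdd (c := M) hg.aestronglyMeasurable ?_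
  exact (ae_restrict_iff' measurableSet_Ioc).2
    (.of_forall fun τ hτ => hM τ (Ioc_subset_Icc_self hτ))

theorem sum_unitSeq_le {α b : ℝ} (hα : α ∈ Ioo (0 : ℝ) 2) (hb : 0 < b) (n : ℕ) :
    ∀ t ∈ Icc (0 : ℝ) 1, ∑ i ∈ Finset.range n, unitSeq α b i t ≤
      1 - Cc α * (t * (1 - t)) ^ (α / 2) * exteriorMass α := by
  have hκ := Cc_pos hα
  have hA := exteriorMass_pos hα
  have hw : ∀ t ∈ Icc (0 : ℝ) 1, 0 ≤ Cc α * (t * (1 - t)) ^ (α / 2) * exteriorMass α := by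
    intro t ht
    have : 0 ≤ t * (1 - t) := mul_nonneg ht.1 (by linarith [ht.2])
    positivity
  induction n with
  | zero =>
    intro t ht
    have h1 := integral_Pker_le hα ht hb
    have h2 := unitSeq_nonneg hα hb 0 t ht
    have h3 : 0 ≤ ∫ τ in (0 : ℝ)..1, Pker α 0 t (-b - τ) :=
      intervalIntegral.integral_nonneg (by linarith) fun τ hτ =>
        Pker_nonneg hα ht (by nlinarith [hτ.1])
    simp only [unitSeq] at h2
    simp only [Finset.range_zero, Finset.sum_empty]
    linarith
  | succ n ih =>
    intro t ht
    have hle : ∀ i ∈ Finset.range n, ∀ τ ∈ Icc (0 : ℝ) 1, |unitSeq α b i τ| ≤ 1 := by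
      intro i hi τ hτ
      rw [abs_of_nonneg (unitSeq_nonneg hα hb i τ hτ)]
      have := Finset.single_le_sum (f := fun i => unitSeq α b i τ)
        (fun j _ => unitSeq_nonneg hα hb j τ hτ) hi
      have := ih τ hτ
      have := hw τ hτ
      linarith
    rw [Finset.sum_range_succ']
    simp only [unitSeq]
    rw [← intervalIntegral.integral_finsetSum fun i hi =>
      intervalIntegrable_Pker_mul hα ht hb (measurable_unitSeq hb i) (hle i hi)]
    have h1 : ∫ τ in (0 : ℝ)..1, ∑ i ∈ Finset.range n, Pker α 0 t (-b - τ) * unitSeq α b i τ ≤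
        ∫ τ in (0 : ℝ)..1, Pker α 0 t (-b - τ) := by
      refine intervalIntegral.integral_mono_on zero_le_one ?_
        (intervalIntegrable_Pker_sub hα ht hb) fun τ hτ => ?_
      · have := IntervalIntegrable.sum (Finset.range n) fun i hi =>
          intervalIntegrable_Pker_mul hα ht hb (measurable_unitSeq hb i) (hle i hi)
        simpa [Finset.sum_fn] using this
      · rw [← Finset.mul_sum]
        exact mul_le_of_le_one_right (Pker_nonneg hα ht (by nlinarith [hτ.1]))
          (by linarith [ih τ hτ, hw τ hτ])
    linarith [integral_Pker_le hα ht hb]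

theorem unitSeq_le_one {α b t : ℝ} (hα : α ∈ Ioo (0 : ℝ) 2) (hb : 0 < b) (n : ℕ)
    (ht : t ∈ Icc (0 : ℝ) 1) : unitSeq α b n t ≤ 1 := by
  have hκ := Cc_pos hα
  have hA := exteriorMass_pos hα
  have h0 : 0 ≤ t * (1 - t) := mul_nonneg ht.1 (by linarith [ht.2])
  have hw : 0 ≤ Cc α * (t * (1 - t)) ^ (α / 2) * exteriorMass α := by positivity
  have h1 := sum_unitSeq_le hα hb (n + 1) t ht
  have h2 := Finset.single_le_sum (f := fun i => unitSeq α b i t)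
    (fun j _ => unitSeq_nonneg hα hb j t ht) (Finset.self_mem_range_succ n)
  linarith

theorem abs_unitSeq_le_one {α b t : ℝ} (hα : α ∈ Ioo (0 : ℝ) 2) (hb : 0 < b) (n : ℕ)
    (ht : t ∈ Icc (0 : ℝ) 1) : |unitSeq α b n t| ≤ 1 := by
  rw [abs_of_nonneg (unitSeq_nonneg hα hb n t ht)]
  exact unitSeq_le_one hα hb n ht

theorem unitSeq_le_pow {α b b₀ : ℝ} (hα : α ∈ Ioo (0 : ℝ) 2) (hb₀ : 0 < b₀) (hb : b₀ ≤ b)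
    (n : ℕ) : ∀ t ∈ Icc (0 : ℝ) 1, unitSeq α b n t ≤ contractionRatio α b₀ ^ n := by
  have hb' := hb₀.trans_le hb
  have hθ := contractionRatio_nonneg hα hb₀
  induction n with
  | zero =>
    intro t ht
    simpa using unitSeq_le_one hα hb' 0 ht
  | succ n ih =>
    intro t ht
    have h1 := integral_Pker_le_contractionRatio hα ht hb₀ hb
    calc unitSeq α b (n + 1) t
        ≤ ∫ τ in (0 : ℝ)..1, Pker α 0 t (-b - τ) * contractionRatio α b₀ ^ n := by
          refine intervalIntegral.integral_mono_on zero_le_one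
            (intervalIntegrable_Pker_mul hα ht hb' (measurable_unitSeq hb' n)
              fun τ hτ => abs_unitSeq_le_one hα hb' n hτ)
            ((intervalIntegrable_Pker_sub hα ht hb').mul_const _) fun τ hτ => ?_
          exact mul_le_mul_of_nonneg_left (ih τ hτ) (Pker_nonneg hα ht (by nlinarith [hτ.1]))
      _ ≤ _ := by
          rw [intervalIntegral.integral_mul_const, pow_succ']
          gcongr

theorem continuousAt_Pker_sub {α t b τ : ℝ} (hα : α ∈ Ioo (0 : ℝ) 2) (ht : t ∈ Icc (0 : ℝ) 1)
    (hb : 0 < b) (hτ : 0 ≤ τ) : ContinuousAt (fun b => Pker α 0 t (-b - τ)) b := by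
  have h1 : 0 < (-b - τ) * (-b - τ - 1) := by nlinarith
  have h2 : 0 < t - (-b - τ) := by linarith [ht.1]
  have h3 : 0 < α := hα.1
  simp only [Pker, sub_zero]
  refine ContinuousAt.mul (ContinuousAt.mul continuousAt_const
    (ContinuousAt.rpow_const (ContinuousAt.div continuousAt_const (by fun_prop) h1.ne')
      (.inr (by linarith)))) (ContinuousAt.inv₀ (by fun_prop) (abs_pos.2 h2.ne').ne')

theorem continuousOn_unitSeq {α : ℝ} (hα : α ∈ Ioo (0 : ℝ) 2) (n : ℕ) :
    ∀ t ∈ Icc (0 : ℝ) 1, ContinuousOn (fun b => unitSeq α b n t) (Ioi 0) := by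
  induction n with
  | zero =>
    intro t ht
    rcases eq_or_ne (t * (1 - t)) 0 with h | h
    · simpa [unitSeq, Pker_of_mul_eq_zero hα h] using continuousOn_const
    · have ht' : t ∈ Ioo (0 : ℝ) 1 := by
        refine ⟨ht.1.lt_of_ne ?_, ht.2.lt_of_ne ?_⟩ <;> rintro rfl <;> simp at h
      have hi : Integrable ((Iic (0 : ℝ)).indicator fun z => Pker α 0 t z) := by
        rw [integrable_indicator_iff measurableSet_Iic, integrableOn_Iic_iff_integrableOn_Iio]
        exact integrableOn_Pker_Iio hα ht'
      have hc := (intervalIntegral.continuous_primitive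
        (fun _ _ => hi.intervalIntegrable) 0).comp continuous_neg
      refine hc.neg.continuousOn.congr fun b hb => ?_
      have hb : 0 < b := hb
      change _ = -∫ z in (0 : ℝ)..(-b), (Iic (0 : ℝ)).indicator (fun z => Pker α 0 t z) z
      rw [← intervalIntegral.integral_symm]
      refine intervalIntegral.integral_congr fun z hz => ?_
      rw [uIcc_of_le (by linarith)] at hz
      exact (indicator_of_mem (show z ∈ Iic (0 : ℝ) from hz.2) _).symm
  | succ n ih =>
    intro t ht b₁ hb₁
    have hb₁ : 0 < b₁ := hb₁
    have hκ := Cc_pos hα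
    have ht' : 0 ≤ t * (1 - t) := mul_nonneg ht.1 (by linarith [ht.2])
    refine ContinuousAt.continuousWithinAt ?_
    refine intervalIntegral.continuousAt_of_dominated_interval
      (bound := fun _ => Cc α * (t * (1 - t)) ^ (α / 2) * Phi α 0 (-(b₁ / 2))) ?_ ?_ (by simp) ?_
    · filter_upwards [lt_mem_nhds hb₁] with b hb
      exact (((measurable_Pker_right α 0 t).comp (measurable_const.sub measurable_id)).mul
        (measurable_unitSeq hb n)).aestronglyMeasurable
    · filter_upwards [lt_mem_nhds (show b₁ / 2 < b₁ by linarith)] with b hb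
      refine .of_forall fun τ hτ => ?_
      rw [uIoc_of_le zero_le_one] at hτ
      have hτ' := Ioc_subset_Icc_self hτ
      have hb0 : 0 < b := by linarith
      have h1 := Pker_nonneg hα ht (y := -b - τ) (by nlinarith [hτ.1])
      have h2 := Pker_le_mul_Phi hα ht (w := -b - τ) (by linarith [hτ.1])
      have h3 := Phi_monotoneOn hα (a := -b - τ) (b := -(b₁ / 2))
        (by simp only [mem_Iio]; linarith [hτ.1]) (by simp only [mem_Iio]; linarith)
        (by linarith [hτ.1])
      rw [norm_mul, Real.norm_of_nonneg h1]
      refine (mul_le_of_le_one_right h1 (abs_unitSeq_le_one hα hb0 n hτ')).trans (h2.trans ?_)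
      gcongr
    · refine .of_forall fun τ hτ => ?_
      rw [uIoc_of_le zero_le_one] at hτ
      exact (continuousAt_Pker_sub hα ht hb₁ hτ.1.le).mul
        ((ih τ (Ioc_subset_Icc_self hτ)).continuousAt (Ioi_mem_nhds hb₁))

/-- The function `ff` transported to the unit interval. -/
noncomputable def unitSum (α b t : ℝ) : ℝ := ∑' n, unitSeq α b n t

theorem summable_unitSeq {α b t : ℝ} (hα : α ∈ Ioo (0 : ℝ) 2) (hb : 0 < b)
    (ht : t ∈ Icc (0 : ℝ) 1) : Summable fun n => unitSeq α b n t :=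
  Summable.of_nonneg_of_le (fun n => unitSeq_nonneg hα hb n t ht)
    (fun n => unitSeq_le_pow hα hb le_rfl n t ht)
    (summable_geometric_of_lt_one (contractionRatio_nonneg hα hb) (contractionRatio_lt_one hα hb))

theorem unitSum_nonneg {α b t : ℝ} (hα : α ∈ Ioo (0 : ℝ) 2) (hb : 0 < b)
    (ht : t ∈ Icc (0 : ℝ) 1) : 0 ≤ unitSum α b t :=
  tsum_nonneg fun n => unitSeq_nonneg hα hb n t ht

theorem unitSum_le {α b t : ℝ} (hα : α ∈ Ioo (0 : ℝ) 2) (hb : 0 < b) (ht : t ∈ Icc (0 : ℝ) 1) :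
    unitSum α b t ≤ 1 - Cc α * (t * (1 - t)) ^ (α / 2) * exteriorMass α :=
  Real.tsum_le_of_sum_range_le (fun n => unitSeq_nonneg hα hb n t ht)
    fun n => sum_unitSeq_le hα hb n t ht

theorem unitSum_le_one {α b t : ℝ} (hα : α ∈ Ioo (0 : ℝ) 2) (hb : 0 < b)
    (ht : t ∈ Icc (0 : ℝ) 1) : unitSum α b t ≤ 1 := by
  have hκ := Cc_pos hα
  have hA := exteriorMass_pos hα
  have h0 : 0 ≤ t * (1 - t) := mul_nonneg ht.1 (by linarith [ht.2])
  have hw : 0 ≤ Cc α * (t * (1 - t)) ^ (α / 2) * exteriorMass α := by positivity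
  linarith [unitSum_le hα hb ht]

theorem continuousOn_unitSum {α t : ℝ} (hα : α ∈ Ioo (0 : ℝ) 2) (ht : t ∈ Icc (0 : ℝ) 1) :
    ContinuousOn (fun b => unitSum α b t) (Ioi 0) := by
  intro b₁ hb₁
  have hb₁ : 0 < b₁ := hb₁
  have hb₀ : 0 < b₁ / 2 := by positivity
  have h : ContinuousOn (fun b => unitSum α b t) (Ioi (b₁ / 2)) := by
    refine continuousOn_tsum (u := fun n => contractionRatio α (b₁ / 2) ^ n)
      (fun n => (continuousOn_unitSeq hα n t ht).mono (Ioi_subset_Ioi hb₀.le))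
      (summable_geometric_of_lt_one (contractionRatio_nonneg hα hb₀)
        (contractionRatio_lt_one hα hb₀)) fun n b hb => ?_
    have hb : b₁ / 2 < b := hb
    rw [Real.norm_of_nonneg (unitSeq_nonneg hα (hb₀.trans hb) n t ht)]
    exact unitSeq_le_pow hα hb₀ hb.le n t ht
  exact (h.continuousAt (Ioi_mem_nhds (by linarith))).continuousWithinAt

theorem aestronglyMeasurable_unitSum {α b : ℝ} (hα : α ∈ Ioo (0 : ℝ) 2) (hb : 0 < b) :
    AEStronglyMeasurable (unitSum α b) (volume.restrict (Ioc 0 1)) := by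
  refine (aemeasurable_of_tendsto_metrizable_ae atTop
    (f := fun n t => ∑ i ∈ Finset.range n, unitSeq α b i t) (fun n => ?_) ?_).aestronglyMeasurable
  · exact (Finset.measurable_sum _ fun i _ => measurable_unitSeq hb i).aemeasurable
  · exact (ae_restrict_iff' measurableSet_Ioc).2 (.of_forall fun t ht =>
      (summable_unitSeq hα hb (Ioc_subset_Icc_self ht)).hasSum.tendsto_sum_nat)

theorem integrableOn_Phi_Iio {α b : ℝ} (hα : α ∈ Ioo (0 : ℝ) 2) (hb : 0 < b) :
    IntegrableOn (Phi α 0) (Iio (-b)) := by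
  have h0 : 0 < α := hα.1
  have h : IntegrableOn (fun w : ℝ => w ^ (-α - 1)) (Ioi b) :=
    integrableOn_Ioi_rpow_of_lt (by linarith) hb
  have h' : IntegrableOn (fun w : ℝ => (-w) ^ (-α - 1)) (Iio (-b)) := by
    have := h.comp_neg
    simpa using this
  refine h'.mono' (measurable_Phi α 0).aestronglyMeasurable ?_
  refine (ae_restrict_iff' measurableSet_Iio).2 (.of_forall fun w hw => ?_)
  have hw : w < -b := hw
  have hw' : 0 < -w := by linarith
  rw [Real.norm_of_nonneg (Phi_nonneg (by nlinarith))]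
  simp only [Phi, sub_zero]
  rw [abs_of_neg (by linarith), Real.rpow_sub_one hw'.ne', div_eq_mul_inv]
  have h1 : (w * (w - 1)) ^ (-(α / 2)) ≤ ((-w) ^ (2 : ℝ)) ^ (-(α / 2)) := by
    refine Real.rpow_le_rpow_of_nonpos (by positivity) ?_ (by linarith)
    norm_num
    nlinarith
  rw [← Real.rpow_mul hw'.le, show (2 : ℝ) * -(α / 2) = -α by ring] at h1
  exact mul_le_mul_of_nonneg_right h1 (inv_nonneg.2 hw'.le)

theorem sub_left_preimage_Iio (b : ℝ) : (fun z : ℝ => -b - z) ⁻¹' Iio (-b) = Ioi 0 := by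
  ext z; simp

theorem integrableOn_Phi_sub {α b : ℝ} (hα : α ∈ Ioo (0 : ℝ) 2) (hb : 0 < b) :
    IntegrableOn (fun z => Phi α 0 (-b - z)) (Ioi 0) := by
  have h := (Measure.measurePreserving_sub_left volume (-b)).integrableOn_comp_preimage
    (MeasurableEquiv.subLeft (-b)).measurableEmbedding (f := Phi α 0) (s := Iio (-b))
  rw [sub_left_preimage_Iio] at h
  exact h.2 (integrableOn_Phi_Iio hα hb)

/-- The bracket in the definition of `Psi`, transported to the unit interval. -/
noncomputable def unitFlux (α b : ℝ) : ℝ :=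
  exteriorMass α + (∫ z in Ioi (0 : ℝ), Phi α 0 (-b - z)) -
    ∫ z in (0 : ℝ)..1, Phi α 0 (-b - z) * unitSum α b z

theorem Phi_sub_le {α b b₀ z : ℝ} (hα : α ∈ Ioo (0 : ℝ) 2) (hb₀ : 0 < b₀) (hb : b₀ ≤ b)
    (hz : 0 ≤ z) : Phi α 0 (-b - z) ≤ Phi α 0 (-b₀ - z) :=
  Phi_monotoneOn hα (by simp only [mem_Iio]; linarith) (by simp only [mem_Iio]; linarith)
    (by linarith)

theorem continuousAt_Phi_sub {α b z : ℝ} (hb : 0 < b) (hz : 0 ≤ z) :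
    ContinuousAt (fun b => Phi α 0 (-b - z)) b := by
  have h1 : 0 < (-b - z) * (-b - z - 1) := by nlinarith
  have h2 : -b - z ≠ 0 := by linarith
  simp only [Phi, sub_zero]
  exact ContinuousAt.mul (ContinuousAt.rpow_const (by fun_prop) (.inl h1.ne'))
    (ContinuousAt.inv₀ (by fun_prop) (abs_pos.2 h2).ne')

theorem measurable_Phi_sub (α b : ℝ) : Measurable fun z => Phi α 0 (-b - z) :=
  (measurable_Phi α 0).comp (measurable_const.sub measurable_id)

theorem continuousOn_unitFlux {α : ℝ} (hα : α ∈ Ioo (0 : ℝ) 2) :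
    ContinuousOn (unitFlux α) (Ioi 0) := by
  intro b₁ hb₁
  have hb₁ : 0 < b₁ := hb₁
  have hb₀ : 0 < b₁ / 2 := by positivity
  refine ContinuousAt.continuousWithinAt (ContinuousAt.sub (ContinuousAt.add
    continuousAt_const ?_) ?_)
  · refine continuousAt_of_dominated (bound := fun z => Phi α 0 (-(b₁ / 2) - z))
      (.of_forall fun b => (measurable_Phi_sub α b).aestronglyMeasurable) ?_
      (integrableOn_Phi_sub hα hb₀) ?_
    · filter_upwards [lt_mem_nhds (show b₁ / 2 < b₁ by linarith)] with b hb
      refine (ae_restrict_iff' measurableSet_Ioi).2 (.of_forall fun z hz => ?_)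
      have hz : 0 < z := hz
      rw [Real.norm_of_nonneg (Phi_nonneg (by nlinarith))]
      exact Phi_sub_le hα hb₀ hb.le hz.le
    · exact (ae_restrict_iff' measurableSet_Ioi).2
        (.of_forall fun z hz => continuousAt_Phi_sub hb₁ (le_of_lt hz))
  · refine intervalIntegral.continuousAt_of_dominated_interval
      (bound := fun _ => Phi α 0 (-(b₁ / 2))) ?_ ?_ (by simp) ?_
    · filter_upwards [lt_mem_nhds hb₁] with b hb
      rw [uIoc_of_le zero_le_one]
      exact (measurable_Phi_sub α b).aestronglyMeasurable.mul (aestronglyMeasurable_unitSum hα hb)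
    · filter_upwards [lt_mem_nhds (show b₁ / 2 < b₁ by linarith)] with b hb
      refine .of_forall fun z hz => ?_
      rw [uIoc_of_le zero_le_one] at hz
      have hz' := Ioc_subset_Icc_self hz
      have hb0 : 0 < b := by linarith
      have h1 : 0 ≤ Phi α 0 (-b - z) := Phi_nonneg (by nlinarith [hz.1])
      rw [norm_mul, Real.norm_of_nonneg h1, Real.norm_of_nonneg (unitSum_nonneg hα hb0 hz')]
      refine (mul_le_of_le_one_right h1 (unitSum_le_one hα hb0 hz')).trans ?_
      exact Phi_monotoneOn hα (by simp only [mem_Iio]; linarith [hz.1])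
        (by simp only [mem_Iio]; linarith) (by linarith [hz.1])
    · refine .of_forall fun z hz => ?_
      rw [uIoc_of_le zero_le_one] at hz
      exact (continuousAt_Phi_sub hb₁ hz.1.le).mul
        ((continuousOn_unitSum hα (Ioc_subset_Icc_self hz)).continuousAt (Ioi_mem_nhds hb₁))

theorem intervalIntegrable_Phi_sub {α b : ℝ} (hα : α ∈ Ioo (0 : ℝ) 2) (hb : 0 < b) :
    IntervalIntegrable (fun z => Phi α 0 (-b - z)) volume 0 1 := by
  rw [intervalIntegrable_iff_integrableOn_Ioc_of_le zero_le_one]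
  exact (integrableOn_Phi_sub hα hb).mono_set fun z hz => hz.1

theorem intervalIntegrable_Phi_mul_unitSum {α b : ℝ} (hα : α ∈ Ioo (0 : ℝ) 2) (hb : 0 < b) :
    IntervalIntegrable (fun z => Phi α 0 (-b - z) * unitSum α b z) volume 0 1 := by
  have h := intervalIntegrable_Phi_sub hα hb
  rw [intervalIntegrable_iff_integrableOn_Ioc_of_le zero_le_one] at h ⊢
  refine h.mul_bdd (c := 1) (aestronglyMeasurable_unitSum hα hb) ?_
  refine (ae_restrict_iff' measurableSet_Ioc).2 (.of_forall fun z hz => ?_)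
  rw [Real.norm_of_nonneg (unitSum_nonneg hα hb (Ioc_subset_Icc_self hz))]
  exact unitSum_le_one hα hb (Ioc_subset_Icc_self hz)

theorem exteriorMass_add_le_unitFlux {α b : ℝ} (hα : α ∈ Ioo (0 : ℝ) 2) (hb : 0 < b) :
    exteriorMass α + ∫ z in (0 : ℝ)..1, Phi α 0 (-b - z) * (1 - unitSum α b z) ≤
      unitFlux α b := by
  have h1 : ∫ z in (0 : ℝ)..1, Phi α 0 (-b - z) ≤ ∫ z in Ioi (0 : ℝ), Phi α 0 (-b - z) := by
    rw [intervalIntegral.integral_of_le zero_le_one]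
    refine setIntegral_mono_set (integrableOn_Phi_sub hα hb) ?_
      (LE.le.eventuallyLE fun z hz => hz.1)
    refine (ae_restrict_iff' measurableSet_Ioi).2 (.of_forall fun z hz => ?_)
    have hz : 0 < z := hz
    exact Phi_nonneg (by nlinarith)
  simp_rw [mul_sub, mul_one]
  rw [intervalIntegral.integral_sub (intervalIntegrable_Phi_sub hα hb)
    (intervalIntegrable_Phi_mul_unitSum hα hb), unitFlux]
  linarith

theorem exteriorMass_le_unitFlux {α b : ℝ} (hα : α ∈ Ioo (0 : ℝ) 2) (hb : 0 < b) :
    exteriorMass α ≤ unitFlux α b := by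
  refine le_trans (le_add_of_nonneg_right ?_) (exteriorMass_add_le_unitFlux hα hb)
  exact intervalIntegral.integral_nonneg zero_le_one fun z hz =>
    mul_nonneg (Phi_nonneg (by nlinarith [hz.1])) (by linarith [unitSum_le_one hα hb hz])

theorem inv_le_Phi_mul {α z : ℝ} (hα : α ∈ Ioo (0 : ℝ) 2) (hz : 0 < z) (hz' : z ≤ 1 / 2) :
    8 ^ (-(α / 2)) / 2 * z⁻¹ ≤ Phi α 0 (-(2 * z)) * (z * (1 - z)) ^ (α / 2) := by
  have h0 : 0 < α := hα.1
  have hc : 0 < z * (1 - z) := mul_pos hz (by linarith)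
  have h1 : (8 * (z * (1 - z))) ^ (-(α / 2)) ≤ (-(2 * z) * (-(2 * z) - 1)) ^ (-(α / 2)) :=
    Real.rpow_le_rpow_of_nonpos (by nlinarith) (by nlinarith) (by linarith)
  simp only [Phi, sub_zero]
  rw [Real.mul_rpow (by norm_num) hc.le] at h1
  rw [abs_of_neg (by linarith)]
  have h2 : (z * (1 - z)) ^ (-(α / 2)) * (z * (1 - z)) ^ (α / 2) = 1 := by
    rw [← Real.rpow_add hc]; simp
  have h3 : 0 < - -(2 * z) := by linarith
  calc (8 : ℝ) ^ (-(α / 2)) / 2 * z⁻¹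
      = 8 ^ (-(α / 2)) * (z * (1 - z)) ^ (-(α / 2)) * (- -(2 * z))⁻¹ *
          (z * (1 - z)) ^ (α / 2) := by
        rw [neg_neg, mul_inv]
        linear_combination (-(8 : ℝ) ^ (-(α / 2)) / 2 * z⁻¹) * h2
    _ ≤ _ := by gcongr

theorem log_le_unitFlux {α b : ℝ} (hα : α ∈ Ioo (0 : ℝ) 2) (hb : 0 < b) (hb' : b ≤ 1 / 2) :
    Cc α * exteriorMass α * (8 ^ (-(α / 2)) / 2) * Real.log (1 / 2 / b) ≤ unitFlux α b := by
  have hκ := Cc_pos hα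
  have hA := exteriorMass_pos hα
  refine le_trans ?_ (exteriorMass_add_le_unitFlux hα hb)
  have hint : IntervalIntegrable (fun z => Phi α 0 (-b - z) * (1 - unitSum α b z)) volume 0 1 := by
    simp_rw [mul_sub, mul_one]
    exact (intervalIntegrable_Phi_sub hα hb).sub (intervalIntegrable_Phi_mul_unitSum hα hb)
  have hint' : IntervalIntegrable (fun z => Phi α 0 (-b - z) * (1 - unitSum α b z)) volume
      b (1 / 2) := by
    refine hint.mono_set ?_
    rw [uIcc_of_le hb', uIcc_of_le zero_le_one]
    exact Icc_subset_Icc hb.le (by norm_num)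
  have h1 : ∫ z in b..(1 / 2), Phi α 0 (-b - z) * (1 - unitSum α b z) ≤
      ∫ z in (0 : ℝ)..1, Phi α 0 (-b - z) * (1 - unitSum α b z) := by
    refine intervalIntegral.integral_mono_interval hb.le hb' (by norm_num) ?_ hint
    refine (ae_restrict_iff' measurableSet_Ioc).2 (.of_forall fun z hz => ?_)
    exact mul_nonneg (Phi_nonneg (by nlinarith [hz.1]))
      (by linarith [unitSum_le_one hα hb (Ioc_subset_Icc_self hz)])
  have h2 : Cc α * exteriorMass α * (8 ^ (-(α / 2)) / 2) * Real.log (1 / 2 / b) ≤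
      ∫ z in b..(1 / 2), Phi α 0 (-b - z) * (1 - unitSum α b z) := by
    rw [← integral_inv_of_pos hb (by norm_num), ← intervalIntegral.integral_const_mul]
    refine intervalIntegral.integral_mono_on hb' ?_ hint' fun z hz => ?_
    · refine IntervalIntegrable.const_mul (intervalIntegral.intervalIntegrable_inv
        (fun z hz => ?_) continuousOn_id) _
      rw [uIcc_of_le hb'] at hz
      exact (hb.trans_le hz.1).ne'
    · have hz0 : 0 < z := hb.trans_le hz.1
      have hz1 : z ∈ Icc (0 : ℝ) 1 := ⟨hz0.le, by linarith [hz.2]⟩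
      have e1 := inv_le_Phi_mul hα hz0 hz.2
      have e2 : Phi α 0 (-(2 * z)) ≤ Phi α 0 (-b - z) :=
        Phi_monotoneOn hα (by simp only [mem_Iio]; linarith) (by simp only [mem_Iio]; linarith)
          (by linarith [hz.1])
      have e3 := unitSum_le hα hb hz1
      have e4 : 0 ≤ Phi α 0 (-b - z) := Phi_nonneg (by nlinarith)
      have e5 : 0 ≤ z * (1 - z) := mul_nonneg hz0.le (by linarith [hz1.2])
      calc Cc α * exteriorMass α * (8 ^ (-(α / 2)) / 2) * z⁻¹
          = Cc α * exteriorMass α * (8 ^ (-(α / 2)) / 2 * z⁻¹) := by ring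
        _ ≤ Cc α * exteriorMass α * (Phi α 0 (-b - z) * (z * (1 - z)) ^ (α / 2)) := by
          refine mul_le_mul_of_nonneg_left (e1.trans ?_) (by positivity)
          gcongr
        _ = Phi α 0 (-b - z) * (Cc α * (z * (1 - z)) ^ (α / 2) * exteriorMass α) := by ring
        _ ≤ _ := by
          refine mul_le_mul_of_nonneg_left ?_ e4
          linarith
  linarith

theorem Pker_affine {α a t y : ℝ} (ha : a < 1) :
    Pker α a (a + (1 - a) * t) (a + (1 - a) * y) = (1 - a)⁻¹ * Pker α 0 t y := by
  have h : 0 < 1 - a := by linarith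
  simp only [Pker, sub_zero]
  rw [show (a + (1 - a) * t - a) * (1 - (a + (1 - a) * t)) = (1 - a) ^ 2 * (t * (1 - t)) by ring,
    show (a + (1 - a) * y - a) * (a + (1 - a) * y - 1) = (1 - a) ^ 2 * (y * (y - 1)) by ring,
    mul_div_mul_left _ _ (pow_pos h 2).ne',
    show a + (1 - a) * t - (a + (1 - a) * y) = (1 - a) * (t - y) by ring, abs_mul,
    abs_of_pos h, mul_inv]
  ring

theorem Phi_affine {α a y : ℝ} (ha : a < 1) (hy : 0 ≤ y * (y - 1)) :
    Phi α a (a + (1 - a) * y) = (1 - a) ^ (-α) * (1 - a)⁻¹ * Phi α 0 y := by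
  have h : 0 < 1 - a := by linarith
  simp only [Phi, sub_zero]
  rw [show (a + (1 - a) * y - a) * (a + (1 - a) * y - 1) =
      (1 - a) ^ (2 : ℝ) * (y * (y - 1)) by norm_num; ring,
    Real.mul_rpow (by positivity) hy, ← Real.rpow_mul h.le,
    show a + (1 - a) * y - a = (1 - a) * y by ring, abs_mul, abs_of_pos h, mul_inv,
    show (2 : ℝ) * -(α / 2) = -α by ring]
  ring

theorem neg_affine {a z : ℝ} (ha : a < 1) :
    -(a + (1 - a) * z) = a + (1 - a) * (-(2 * a / (1 - a)) - z) := by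
  have h : 1 - a ≠ 0 := by linarith
  field_simp
  ring

theorem intervalIntegral_affine {a : ℝ} (f : ℝ → ℝ) :
    ∫ y in a..(1 : ℝ), f y = (1 - a) * ∫ z in (0 : ℝ)..1, f (a + (1 - a) * z) := by
  rw [intervalIntegral.mul_integral_comp_add_mul]
  simp

theorem setIntegral_Ioi_affine {a c : ℝ} (ha : a < 1) (f : ℝ → ℝ) :
    ∫ y in Ioi (a + (1 - a) * c), f y = (1 - a) * ∫ z in Ioi c, f (a + (1 - a) * z) := by
  have h : 0 < 1 - a := by linarith
  have himg : (fun z => a + (1 - a) * z) '' Ioi c = Ioi (a + (1 - a) * c) := by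
    ext y
    constructor
    · rintro ⟨z, hz, rfl⟩
      have hz : c < z := hz
      simp only [mem_Ioi]
      gcongr
    · intro hy
      have hy : a + (1 - a) * c < y := hy
      refine ⟨(y - a) / (1 - a), ?_, by field_simp; ring⟩
      rw [mem_Ioi, lt_div_iff₀ h]
      linarith
  rw [← himg, integral_image_eq_integral_abs_deriv_smul measurableSet_Ioi
    (f' := fun _ => 1 - a) (fun z _ => ?_) (fun z _ w _ hzw => ?_)]
  · simp only [abs_of_pos h, smul_eq_mul]
    rw [integral_const_mul]
  · simpa using (((hasDerivAt_id z).const_mul (1 - a)).const_add a).hasDerivWithinAt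
  · exact mul_left_cancel₀ h.ne' (add_left_cancel hzw)

theorem fseq_affine {α a : ℝ} (ha : a < 1) (n : ℕ) :
    ∀ t, fseq α a n (a + (1 - a) * t) = unitSeq α (2 * a / (1 - a)) n t := by
  have h : 1 - a ≠ 0 := by linarith
  induction n with
  | zero =>
    intro t
    simp only [fseq, unitSeq]
    have := intervalIntegral.mul_integral_comp_add_mul
      (f := fun y => Pker α a (a + (1 - a) * t) y) (c := 1 - a) (d := a)
      (a := -(2 * a / (1 - a))) (b := 0)
    rw [show a + (1 - a) * -(2 * a / (1 - a)) = -a by field_simp; ring, mul_zero, add_zero] at this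
    rw [← this]
    simp_rw [Pker_affine ha]
    rw [intervalIntegral.integral_const_mul, mul_inv_cancel_left₀ h]
  | succ n ih =>
    intro t
    simp only [fseq, unitSeq]
    rw [intervalIntegral_affine]
    simp_rw [ih, neg_affine ha, Pker_affine ha, mul_assoc]
    rw [intervalIntegral.integral_const_mul, mul_inv_cancel_left₀ h]

theorem ff_affine {α a t : ℝ} (ha : a < 1) :
    ff α a (a + (1 - a) * t) = unitSum α (2 * a / (1 - a)) t := by
  simp only [ff, unitSum, fseq_affine ha]

theorem Psi_eq_unitFlux {α a : ℝ} (ha : a ∈ Ioo (0 : ℝ) 1) :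
    Psi α a = Cc α * (1 - a) ^ (-(α / 2)) * unitFlux α (2 * a / (1 - a)) := by
  obtain ⟨ha0, ha1⟩ := ha
  have h : 0 < 1 - a := by linarith
  have hb : 0 < 2 * a / (1 - a) := by positivity
  set b := 2 * a / (1 - a) with hb'
  have e1 : ∫ y in Ioi (1 : ℝ), Phi α a y = (1 - a) ^ (-α) * exteriorMass α := by
    have := setIntegral_Ioi_affine (c := 1) ha1 (Phi α a)
    rw [show a + (1 - a) * 1 = 1 by ring] at this
    rw [this, setIntegral_congr_fun measurableSet_Ioi fun z hz =>
      Phi_affine ha1 (by have hz : 1 < z := hz; nlinarith), integral_const_mul, exteriorMass]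
    field_simp
  have e2 : ∫ y in Ioi a, Phi α a (-y) =
      (1 - a) ^ (-α) * ∫ z in Ioi (0 : ℝ), Phi α 0 (-b - z) := by
    have := setIntegral_Ioi_affine (c := 0) ha1 fun y => Phi α a (-y)
    rw [mul_zero, add_zero] at this
    have hcongr : ∀ z ∈ Ioi (0 : ℝ), Phi α a (-(a + (1 - a) * z)) =
        (1 - a) ^ (-α) * (1 - a)⁻¹ * Phi α 0 (-b - z) := by
      intro z hz
      have hz : 0 < z := hz
      rw [neg_affine ha1, Phi_affine ha1 (by rw [← hb']; nlinarith)]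
    rw [this, setIntegral_congr_fun measurableSet_Ioi hcongr, integral_const_mul]
    field_simp
  have e3 : ∫ y in a..(1 : ℝ), Phi α a (-y) * ff α a y =
      (1 - a) ^ (-α) * ∫ z in (0 : ℝ)..1, Phi α 0 (-b - z) * unitSum α b z := by
    have hcongr : ∀ z ∈ uIcc (0 : ℝ) 1,
        Phi α a (-(a + (1 - a) * z)) * ff α a (a + (1 - a) * z) =
        (1 - a) ^ (-α) * (1 - a)⁻¹ * (Phi α 0 (-b - z) * unitSum α b z) := by
      intro z hz
      rw [uIcc_of_le zero_le_one] at hz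
      rw [neg_affine ha1, Phi_affine ha1 (by rw [← hb']; nlinarith [hz.1]), ff_affine ha1]
      ring
    rw [intervalIntegral_affine, intervalIntegral.integral_congr hcongr,
      intervalIntegral.integral_const_mul]
    field_simp
  have e4 : (1 - a) ^ (-(α / 2)) = (1 - a) ^ (α / 2) * (1 - a) ^ (-α) := by
    rw [← Real.rpow_add h]
    congr 1
    ring
  rw [Psi, e1, e2, e3, e4, unitFlux]
  ring

theorem continuousOn_Psi {α : ℝ} (hα : α ∈ Ioo (0 : ℝ) 2) :
    ContinuousOn (Psi α) (Ioo 0 1) := by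
  have h1 : ContinuousOn (fun a : ℝ => 2 * a / (1 - a)) (Ioo 0 1) :=
    ContinuousOn.div (by fun_prop) (by fun_prop) fun a ha => by linarith [ha.2]
  have h2 : MapsTo (fun a : ℝ => 2 * a / (1 - a)) (Ioo 0 1) (Ioi 0) := fun a ha =>
    div_pos (mul_pos two_pos ha.1) (sub_pos.2 ha.2)
  have h3 : ContinuousOn (fun a : ℝ => (1 - a) ^ (-(α / 2))) (Ioo 0 1) :=
    ContinuousOn.rpow_const (by fun_prop) fun a ha => .inl (by linarith [ha.2])
  exact ((continuousOn_const.mul h3).mul ((continuousOn_unitFlux hα).comp h1 h2)).congr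
    fun a ha => Psi_eq_unitFlux ha

theorem Psi_ge_rpow {α a : ℝ} (hα : α ∈ Ioo (0 : ℝ) 2) (ha : a ∈ Ioo (0 : ℝ) 1) :
    Cc α * exteriorMass α * (1 - a) ^ (-(α / 2)) ≤ Psi α a := by
  have hκ := Cc_pos hα
  have h : 0 < 1 - a := by linarith [ha.2]
  have hb : 0 < 2 * a / (1 - a) := div_pos (by linarith [ha.1]) h
  rw [Psi_eq_unitFlux ha, mul_right_comm]
  have := exteriorMass_le_unitFlux hα hb
  gcongr

theorem Psi_pos {α a : ℝ} (hα : α ∈ Ioo (0 : ℝ) 2) (ha : a ∈ Ioo (0 : ℝ) 1) : 0 < Psi α a := by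
  have hκ := Cc_pos hα
  have hA := exteriorMass_pos hα
  have h : 0 < 1 - a := by linarith [ha.2]
  exact lt_of_lt_of_le (by positivity) (Psi_ge_rpow hα ha)

theorem tendsto_Psi_one {α : ℝ} (hα : α ∈ Ioo (0 : ℝ) 2) :
    Tendsto (Psi α) (nhdsWithin 1 (Iio 1)) atTop := by
  have hκ := Cc_pos hα
  have hA := exteriorMass_pos hα
  have h1 : Tendsto (fun a : ℝ => 1 - a) (nhdsWithin 1 (Iio 1)) (nhdsWithin 0 (Ioi 0)) := by
    refine tendsto_nhdsWithin_iff.2 ⟨?_, eventually_mem_nhdsWithin.mono fun a ha => ?_⟩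
    · refine Tendsto.mono_left ?_ nhdsWithin_le_nhds
      exact Continuous.tendsto' (by fun_prop) _ _ (by simp)
    · exact sub_pos.2 (mem_Iio.1 ha)
  have h2 := (tendsto_rpow_neg_nhdsGT_zero (y := -(α / 2)) (by linarith [hα.1])).comp h1
  refine tendsto_atTop_mono' _ ?_ (h2.const_mul_atTop (mul_pos hκ hA))
  filter_upwards [Ioo_mem_nhdsLT (zero_lt_one (α := ℝ))] with a ha
  exact Psi_ge_rpow hα ha

theorem tendsto_Psi_zero {α : ℝ} (hα : α ∈ Ioo (0 : ℝ) 2) :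
    Tendsto (Psi α) (nhdsWithin 0 (Ioi 0)) atTop := by
  have hκ := Cc_pos hα
  have hA := exteriorMass_pos hα
  have hb : Tendsto (fun a : ℝ => 2 * a / (1 - a)) (nhdsWithin 0 (Ioi 0))
      (nhdsWithin 0 (Ioi 0)) := by
    refine tendsto_nhdsWithin_iff.2 ⟨?_, ?_⟩
    · refine Tendsto.mono_left ?_ nhdsWithin_le_nhds
      have : ContinuousAt (fun a : ℝ => 2 * a / (1 - a)) 0 :=
        ContinuousAt.div (by fun_prop) (by fun_prop) (by norm_num)
      simpa [ContinuousAt] using this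
    · filter_upwards [Ioo_mem_nhdsGT (zero_lt_one (α := ℝ))] with a ha
      exact div_pos (mul_pos two_pos ha.1) (sub_pos.2 ha.2)
  have hlog : Tendsto (fun b : ℝ => Real.log (1 / 2 / b)) (nhdsWithin 0 (Ioi 0)) atTop := by
    refine Real.tendsto_log_atTop.comp ?_
    simp_rw [div_eq_mul_inv]
    exact tendsto_inv_nhdsGT_zero.const_mul_atTop (by norm_num)
  have hc : 0 < Cc α * (Cc α * exteriorMass α * (8 ^ (-(α / 2)) / 2)) := by positivity
  refine tendsto_atTop_mono' _ ?_ ((hlog.comp hb).const_mul_atTop hc)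
  filter_upwards [Ioo_mem_nhdsGT (zero_lt_one (α := ℝ)),
    hb.eventually (Ioo_mem_nhdsGT (show (0 : ℝ) < 1 / 2 by norm_num))] with a ha hab
  have h : 0 < 1 - a := by linarith [ha.2]
  have h0 := hα.1
  have h1 : 1 ≤ (1 - a) ^ (-(α / 2)) :=
    Real.one_le_rpow_of_pos_of_le_one_of_nonpos h (by linarith [ha.1]) (by linarith)
  have h2 := log_le_unitFlux hα hab.1 hab.2.le
  have h3 := exteriorMass_le_unitFlux hα hab.1
  have h4 : 0 ≤ unitFlux α (2 * a / (1 - a)) := by linarith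
  rw [Psi_eq_unitFlux ha, Function.comp_apply, mul_assoc (Cc α) _ (Real.log _),
    mul_assoc (Cc α) _ (unitFlux _ _)]
  refine mul_le_mul_of_nonneg_left (h2.trans ?_) hκ.le
  exact le_mul_of_one_le_left h4 h1

theorem exists_minimal_level {g : ℝ → ℝ} (hg : ContinuousOn g (Ioo 0 1))
    (hg0 : Tendsto g (nhdsWithin 0 (Ioi 0)) atTop)
    (hg1 : Tendsto g (nhdsWithin 1 (Iio 1)) atTop) :
    ∃ m ∈ Ioo (0 : ℝ) 1, (∀ a ∈ Ioo (0 : ℝ) 1, g m ≤ g a) ∧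
      ∀ μ, g m < μ → 2 ≤ {a : ℝ | a ∈ Ioo (0 : ℝ) 1 ∧ g a = μ}.encard := by
  have hmin : ∃ m ∈ Ioo (0 : ℝ) 1, ∀ a ∈ Ioo (0 : ℝ) 1, g m ≤ g a := by
    obtain ⟨u, hu, hu'⟩ := mem_nhdsGT_iff_exists_Ioo_subset.1
      (hg0.eventually_ge_atTop (g (1 / 2)))
    obtain ⟨v, hv, hv'⟩ := mem_nhdsLT_iff_exists_Ioo_subset.1
      (hg1.eventually_ge_atTop (g (1 / 2)))
    have hu : 0 < u := hu
    have hv : v < 1 := hv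
    have hp : 0 < min u (1 / 2) := by positivity
    have hq : max v (1 / 2) < 1 := max_lt hv (by norm_num)
    obtain ⟨m, hm, hm'⟩ := (isCompact_Icc (a := min u (1 / 2)) (b := max v (1 / 2))).exists_isMinOn
      ⟨1 / 2, min_le_right _ _, le_max_right _ _⟩
      (hg.mono (Icc_subset_Ioo hp hq))
    refine ⟨m, Icc_subset_Ioo hp hq hm, fun a ha => ?_⟩
    have hhalf : g m ≤ g (1 / 2) := hm' ⟨min_le_right _ _, le_max_right _ _⟩
    by_cases h1 : a < min u (1 / 2)
    · exact hhalf.trans (hu' ⟨ha.1, h1.trans_le (min_le_left _ _)⟩)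
    by_cases h2 : max v (1 / 2) < a
    · exact hhalf.trans (hv' ⟨(le_max_left _ _).trans_lt h2, ha.2⟩)
    exact hm' ⟨not_lt.1 h1, not_lt.1 h2⟩
  obtain ⟨m, hm, hmin⟩ := hmin
  refine ⟨m, hm, hmin, fun μ hμ => ?_⟩
  obtain ⟨p, hp, hpm⟩ := ((hg0.eventually_ge_atTop μ).and (Ioo_mem_nhdsGT hm.1)).exists
  obtain ⟨q, hq, hqm⟩ := ((hg1.eventually_ge_atTop μ).and (Ioo_mem_nhdsLT hm.2)).exists
  obtain ⟨x, hx, hxμ⟩ := intermediate_value_Icc' hpm.2.le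
    (hg.mono (Icc_subset_Ioo hpm.1 hm.2)) ⟨hμ.le, hp⟩
  obtain ⟨y, hy, hyμ⟩ := intermediate_value_Icc hqm.1.le
    (hg.mono (Icc_subset_Ioo hm.1 hqm.2)) ⟨hμ.le, hq⟩
  have hxy : x ≠ y := by
    rintro rfl
    have : x = m := le_antisymm hx.2 hy.1
    subst this
    exact hμ.ne hxμ
  rw [← encard_pair hxy]
  refine encard_le_encard ?_
  rintro z (rfl | rfl)
  · exact ⟨⟨hpm.1.trans_le hx.1, hx.2.trans_lt hm.2⟩, hxμ⟩
  · exact ⟨⟨hm.1.trans_le hy.1, hy.2.trans_lt hqm.2⟩, hyμ⟩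

/-- There is a Bernoulli constant `λ* > 0` such that `{Ψ = λ}` has at least two elements for
`λ > λ*`, at least one element for `λ = λ*`, and is empty for `0 < λ < λ*`. -/
theorem Psi_level_set_structure (α : ℝ) (hα : α ∈ Set.Ioo (0:ℝ) 2) :
    ∃ l : ℝ, 0 < l ∧
      (∀ μ : ℝ, l < μ → 2 ≤ {a : ℝ | a ∈ Set.Ioo (0:ℝ) 1 ∧ Psi α a = μ}.encard) ∧
      {a : ℝ | a ∈ Set.Ioo (0:ℝ) 1 ∧ Psi α a = l}.Nonempty ∧
      (∀ μ : ℝ, 0 < μ → μ < l → {a : ℝ | a ∈ Set.Ioo (0:ℝ) 1 ∧ Psi α a = μ} = ∅) := by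
  obtain ⟨m, hm, hmin, htwo⟩ := exists_minimal_level (continuousOn_Psi hα) (tendsto_Psi_zero hα)
    (tendsto_Psi_one hα)
  refine ⟨Psi α m, Psi_pos hα hm, htwo, ⟨m, hm, rfl⟩, fun μ _ hμ => ?_⟩
  refine eq_empty_of_forall_notMem fun a ha => ?_
  linarith [hmin a ha.1, ha.2]
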